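/- arXiv:1901.01959 — 2 statements merged into one kernel-verified Lean document; each statement's English description precedes it below -/
import Mathlib

section
/- Let G be a P4-free simple graph with at least three vertices. Then G has a Hamiltonian cycle if and only if G is 1-tough. -/
open SimpleGraph

variable {V : Type*} {W : Type*}

/-- A graph is `P₄`-free if it contains no induced subgraph isomorphic to the
path on four vertices. -/
def P4Free (G : SimpleGraph V) : Prop := IsEmpty (SimpleGraph.pathGraph 4 ↪g G)

/-- `R` is (the vertex set of) a connected component of `G - S`:
a maximal subset of `V(G) - S` inducing a connected subgraph. -/
def IsCompOf (G : SimpleGraph V) (S R : Set V) : Prop :=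
  R ⊆ Sᶜ ∧ (G.induce R).Connected ∧
    ∀ R' : Set V, R ⊆ R' → R' ⊆ Sᶜ → (G.induce R').Connected → R' = R

/-- The number of connected components of `G - S`. -/
noncomputable def numComp (G : SimpleGraph V) (S : Set V) : ℕ :=
  {R : Set V | IsCompOf G S R}.ncard

/-- `S` is a cutset of `G` : the graph `G - S` is disconnected. -/
def IsCutset (G : SimpleGraph V) (S : Set V) : Prop := 2 ≤ numComp G S

/-- `G` is `t`-tough: for every cutset `S`, `t * c(G - S) ≤ |S|`. -/
def Tough (t : ℝ) (G : SimpleGraph V) : Prop :=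
  ∀ S : Set V, IsCutset G S → t * (numComp G S : ℝ) ≤ (S.ncard : ℝ)

/-- `t` is the toughness of `G` : the largest `s` such that `G` is `s`-tough.
(For a complete graph no such largest `s` exists; the toughness is infinite.) -/
def IsToughness (G : SimpleGraph V) (t : ℝ) : Prop :=
  Tough t G ∧ ∀ s : ℝ, Tough s G → s ≤ t

/-- `S` is a tough-set of `G` (whose toughness is `t`): a cutset with
`|S| = t * c(G - S)`. -/
def ToughSet (G : SimpleGraph V) (t : ℝ) (S : Set V) : Prop :=
  IsCutset G S ∧ (S.ncard : ℝ) = t * (numComp G S : ℝ)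

/-- Vertex `u` is adjacent in `G` to some vertex of the set `R`. -/
def AdjToSet (G : SimpleGraph V) (u : V) (R : Set V) : Prop := ∃ v ∈ R, G.Adj u v

/-- `G` has a Hamiltonian cycle. -/
def HasHamCycle [DecidableEq V] (G : SimpleGraph V) : Prop :=
  ∃ (v : V) (w : G.Walk v v), w.IsHamiltonianCycle

/-- `G` has a spanning `k`-walk: a closed walk visiting every vertex at least once
and at most `k` times.  (In a nontrivial closed walk the base vertex occurs one
extra time in `Walk.support`, whence the correction term.) -/
def HasSpanningKWalk [DecidableEq V] (G : SimpleGraph V) (k : ℕ) : Prop :=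
  ∃ (v : V) (w : G.Walk v v), (∀ x : V, x ∈ w.support) ∧
    ∀ x : V, w.support.count x ≤ k + (if x = v then 1 else 0)

/-- The prism over `G`: the Cartesian (box) product `G □ K₂`. -/
def prism (G : SimpleGraph V) : SimpleGraph (V × Fin 2) :=
  G.boxProd (⊤ : SimpleGraph (Fin 2))

/-- The graph obtained from `G` by contracting the set `R` to a single vertex
(namely `Sum.inr ()`), which is adjacent to exactly those vertices outside `R`
having a neighbor in `R`. -/
def contractSet (G : SimpleGraph V) (R : Set V) : SimpleGraph (↥(Rᶜ) ⊕ Unit) :=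
  SimpleGraph.fromRel fun x y =>
    match x, y with
    | Sum.inl a, Sum.inl b => G.Adj ↑a ↑b
    | Sum.inl a, Sum.inr _ => ∃ r ∈ R, G.Adj ↑a r
    | _, _ => False

/-- `v` is a cutvertex of `H` : deleting `v` leaves a disconnected
(non-preconnected) graph. -/
def IsCutvertex (H : SimpleGraph W) (v : W) : Prop :=
  ¬ (H.induce ({v}ᶜ : Set W)).Preconnected

/-- `B` is a block of `H` : a maximal connected subgraph having no cutvertex of
its own. -/
def IsBlock (H : SimpleGraph W) (B : H.Subgraph) : Prop :=
  B.coe.Connected ∧ (∀ v, ¬ IsCutvertex B.coe v) ∧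
    ∀ B' : H.Subgraph, B ≤ B' → B'.coe.Connected →
      (∀ v, ¬ IsCutvertex B'.coe v) → B' = B

/-- `H` is a cycle of even length. -/
def IsEvenCycleGraph (H : SimpleGraph W) : Prop :=
  ∃ n : ℕ, Even n ∧ 3 ≤ n ∧ Nonempty (H ≃g SimpleGraph.cycleGraph n)

/-- `H` is a single edge. -/
def IsSingleEdgeGraph (H : SimpleGraph W) : Prop :=
  ∃ u v : W, u ≠ v ∧ H.Adj u v ∧ ∀ w : W, w = u ∨ w = v

/-- `H` is a simple block EP (SBEP) graph: a connected graph in which every block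
is an even cycle or a single edge, and every vertex lies in at most two blocks. -/
def IsSBEP (H : SimpleGraph W) : Prop :=
  H.Connected ∧
    (∀ B : H.Subgraph, IsBlock H B → IsEvenCycleGraph B.coe ∨ IsSingleEdgeGraph B.coe) ∧
    ∀ (v : W) (B₁ B₂ B₃ : H.Subgraph),
      IsBlock H B₁ ∧ v ∈ B₁.verts → IsBlock H B₂ ∧ v ∈ B₂.verts →
      IsBlock H B₃ ∧ v ∈ B₃.verts → B₁ = B₂ ∨ B₁ = B₃ ∨ B₂ = B₃

/-- `v` is a single-block vertex of `H` : it lies in exactly one block. -/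
def SingleBlockVertex (H : SimpleGraph W) (v : W) : Prop :=
  ∃! B : H.Subgraph, IsBlock H B ∧ v ∈ B.verts

namespace SimpleGraph

/-- Every path on four vertices has a chord. -/
def PathsHaveChords (G : SimpleGraph V) : Prop :=
  ∀ a b c d, a ≠ c → a ≠ d → b ≠ d → G.Adj a b → G.Adj b c → G.Adj c d →
    G.Adj a c ∨ G.Adj a d ∨ G.Adj b d

lemma PathsHaveChords.of_p4Free {G : SimpleGraph V} (h : P4Free G) : G.PathsHaveChords := by
  intro a b c d hac had hbd hab hbc hcd
  by_contra! hn
  obtain ⟨h1, h2, h3⟩ := hn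
  have hab' := hab.ne
  have hbc' := hbc.ne
  have hcd' := hcd.ne
  refine h.false ⟨⟨![a, b, c, d], ?_⟩, ?_⟩
  · intro i j
    fin_cases i <;> fin_cases j <;> simp_all [eq_comm]
  · intro i j
    change G.Adj (![a, b, c, d] i) (![a, b, c, d] j) ↔ _
    fin_cases i <;> fin_cases j <;> simp_all [pathGraph_adj, adj_comm]

lemma PathsHaveChords.compl {G : SimpleGraph V} (h : G.PathsHaveChords) :
    Gᶜ.PathsHaveChords := by
  intro a b c d hac had hbd hab hbc hcd
  simp only [compl_adj] at *
  have := h c a d b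
  have := G.adj_comm
  grind

/-- The finite set `A` is the disjoint union of two nonempty sets without edges between them. -/
def Separates [DecidableEq V] (G : SimpleGraph V) (A : Finset V) : Prop :=
  ∃ B C : Finset V, B.Nonempty ∧ C.Nonempty ∧ Disjoint B C ∧ B ∪ C = A ∧
    ∀ x ∈ B, ∀ y ∈ C, ¬ G.Adj x y

section

variable {G : SimpleGraph V} {A B S T : Finset V}

lemma Separates.insert [DecidableEq V] (h : G.PathsHaveChords) {v : V} (hv : v ∉ A)
    (hA : G.Separates A) :
    G.Separates (insert v A) ∨ Gᶜ.Separates (insert v A) := by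
  classical
  by_cases hall : ∀ u ∈ A, G.Adj v u
  · obtain ⟨B, C, ⟨b, hb⟩, -, -, rfl, -⟩ := hA
    refine .inr ⟨{v}, B ∪ C, by simp, ⟨b, by simp [hb]⟩, by simpa using hv, rfl, ?_⟩
    intro x hx y hy
    rw [Finset.mem_singleton.mp hx, compl_adj]
    exact fun h ↦ h.2 (hall y hy)
  push Not at hall
  obtain ⟨u, hu, hvu⟩ := hall
  obtain ⟨B, C, hBne, hCne, hd, rfl, hBC, huB⟩ : ∃ B C : Finset V, B.Nonempty ∧ C.Nonempty ∧
      Disjoint B C ∧ B ∪ C = A ∧ (∀ x ∈ B, ∀ y ∈ C, ¬ G.Adj x y) ∧ u ∈ B := by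
    obtain ⟨B, C, hB, hC, hd, rfl, hBC⟩ := hA
    rcases Finset.mem_union.mp hu with hu | hu
    · exact ⟨B, C, hB, hC, hd, rfl, hBC, hu⟩
    · exact ⟨C, B, hC, hB, hd.symm, Finset.union_comm _ _,
        fun x hx y hy hxy ↦ hBC y hy x hx hxy.symm, hu⟩
  have hd' := Finset.disjoint_left.mp hd
  left
  by_contra hns
  obtain ⟨z, hz, hvz⟩ : ∃ z ∈ C, G.Adj v z := by
    by_contra! hno
    refine hns ⟨insert v B, C, by simp, hCne, ?_, by simp, ?_⟩
    · rw [Finset.disjoint_left]; grind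
    · grind
  obtain ⟨x, hx, y, hy, hvx, hvy, hxy⟩ :
      ∃ x ∈ B, ∃ y ∈ B, ¬ G.Adj v x ∧ G.Adj v y ∧ G.Adj x y := by
    by_contra! hno
    refine hns ⟨B.filter (¬ G.Adj v ·), Insert.insert v (B.filter (G.Adj v ·) ∪ C),
      ⟨u, by simp [huB, hvu]⟩, by simp, ?_, ?_, ?_⟩
    · rw [Finset.disjoint_left]; grind
    · grind
    · have := G.adj_comm
      grind
  have hvB : v ∉ B := fun h ↦ hv (Finset.mem_union_left _ h)
  rcases h z v y x (fun h ↦ hd' hy (h ▸ hz)) (fun h ↦ hd' hx (h ▸ hz)) (fun h ↦ hvB (h ▸ hx))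
    hvz.symm hvy hxy.symm with h | h | h
  · exact hBC y hy z hz h.symm
  · exact hBC x hx z hz h.symm
  · exact hvx h

theorem PathsHaveChords.separates_or_compl_separates [DecidableEq V] (h : G.PathsHaveChords)
    (hA : A.Nontrivial) :
    G.Separates A ∨ Gᶜ.Separates A := by
  induction A using Finset.induction_on with
  | empty => simp at hA
  | insert v A hv ih =>
    by_cases hA' : A.Nontrivial
    · rcases ih hA' with ih | ih
      · exact ih.insert h hv
      · have := ih.insert h.compl hv
        rwa [compl_compl, or_comm] at this
    · have hne : A.Nonempty := by
        rw [Finset.nonempty_iff_ne_empty]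
        rintro rfl
        simp at hA
      obtain ⟨u, rfl⟩ := hne.exists_eq_singleton_or_nontrivial.resolve_right hA'
      have hd : Disjoint ({v} : Finset V) {u} := by simpa using hv
      by_cases hvu : G.Adj v u
      · exact .inr ⟨{v}, {u}, by simp, by simp, hd, rfl, by simp [hvu]⟩
      · exact .inl ⟨{v}, {u}, by simp, by simp, hd, rfl, by simp [hvu]⟩

/-- `P` is a list of pairwise disjoint nonempty paths of `G` that together cover exactly `A`. -/
structure IsPathCover (G : SimpleGraph V) (A : Finset V) (P : List (List V)) : Prop where
  ne_nil : ∀ p ∈ P, p ≠ []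
  isChain : ∀ p ∈ P, p.IsChain G.Adj
  coe_flatten : (P.flatten : Multiset V) = A.val

namespace IsPathCover

variable {P Q : List (List V)}

lemma mem (hP : G.IsPathCover A P) {p : List V} (hp : p ∈ P) {x : V} (hx : x ∈ p) : x ∈ A := by
  rw [← Finset.mem_val, ← hP.coe_flatten, Multiset.mem_coe]
  exact List.mem_flatten_of_mem hp hx

lemma length_flatten (hP : G.IsPathCover A P) : P.flatten.length = A.card := by
  rw [← Multiset.coe_card, hP.coe_flatten, Finset.card_val]

lemma append [DecidableEq V] (hP : G.IsPathCover A P) (hQ : G.IsPathCover B Q)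
    (hAB : Disjoint A B) :
    G.IsPathCover (A ∪ B) (P ++ Q) where
  ne_nil p hp := (List.mem_append.mp hp).elim (hP.ne_nil p) (hQ.ne_nil p)
  isChain p hp := (List.mem_append.mp hp).elim (hP.isChain p) (hQ.isChain p)
  coe_flatten := by
    rw [← Finset.disjUnion_eq_union _ _ hAB, Finset.disjUnion_val, ← hP.coe_flatten,
      ← hQ.coe_flatten, List.flatten_append, Multiset.coe_add]

lemma ne_nil_of_nonempty (hP : G.IsPathCover A P) (hA : A.Nonempty) : P ≠ [] := by
  rintro rfl
  exact hA.card_pos.ne hP.length_flatten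

lemma length_le (hP : G.IsPathCover A P) : P.length ≤ A.card := by
  rw [← hP.length_flatten, List.length_flatten]
  have := List.card_nsmul_le_sum (P.map List.length) 1 (by
    simpa [Nat.one_le_iff_ne_zero] using hP.ne_nil)
  simpa using this

lemma exists_length_succ (hP : G.IsPathCover A P) (h : P.length < A.card) :
    ∃ Q, G.IsPathCover A Q ∧ Q.length = P.length + 1 := by
  obtain ⟨p, hp, hlen⟩ : ∃ p ∈ P, 1 < p.length := by
    by_contra! hno
    have := List.sum_le_card_nsmul (P.map List.length) 1 (by simpa using hno)
    rw [← hP.length_flatten, List.length_flatten] at h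
    simp at this
    omega
  obtain ⟨P₁, P₂, rfl⟩ := List.append_of_mem hp
  match p, hlen with
  | x :: y :: t, _ =>
    have h1 := hP.ne_nil
    have h2 := hP.isChain
    refine ⟨P₁ ++ [x] :: (y :: t) :: P₂, ⟨?_, ?_, ?_⟩, by simp; omega⟩
    · simp only [List.mem_append, List.mem_cons] at h1 ⊢
      grind
    · simp only [List.mem_append, List.mem_cons] at h2 ⊢
      have := h2 (x :: y :: t) (by simp)
      rw [List.isChain_cons_cons] at this
      rintro q (hq | rfl | rfl | hq)
      · exact h2 q (.inl hq)
      · simp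
      · exact this.2
      · exact h2 q (.inr (.inr hq))
    · rw [← hP.coe_flatten]
      simp

lemma exists_length_eq (hP : G.IsPathCover A P) {k : ℕ} (hk : P.length ≤ k) (hkA : k ≤ A.card) :
    ∃ Q, G.IsPathCover A Q ∧ Q.length = k := by
  induction k, hk using Nat.le_induction with
  | base => exact ⟨P, hP, rfl⟩
  | succ k _ ih =>
    obtain ⟨Q, hQ, rfl⟩ := ih (by omega)
    exact hQ.exists_length_succ (by omega)

end IsPathCover

lemma exists_isChain_interleave (hAB : ∀ x ∈ A, ∀ y ∈ B, G.Adj x y) (Q P : List (List V))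
    (hlen : P.length = Q.length + 1)
    (hP : ∀ p ∈ P, p ≠ [] ∧ p.IsChain G.Adj ∧ ∀ x ∈ p, x ∈ A)
    (hQ : ∀ q ∈ Q, q ≠ [] ∧ q.IsChain G.Adj ∧ ∀ x ∈ q, x ∈ B) :
    ∃ l : List V, l ≠ [] ∧ l.IsChain G.Adj ∧ (l : Multiset V) = P.flatten + Q.flatten ∧
      (∀ x ∈ l.head?, x ∈ A) ∧ ∀ x ∈ l.getLast?, x ∈ A := by
  induction Q generalizing P with
  | nil =>
    obtain ⟨p, rfl⟩ := List.length_eq_one_iff.mp hlen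
    obtain ⟨h1, h2, h3⟩ := hP p (by simp)
    exact ⟨p, h1, h2, by simp, fun x hx ↦ h3 x (List.mem_of_mem_head? hx),
      fun x hx ↦ h3 x (List.mem_of_mem_getLast? hx)⟩
  | cons q Q ih =>
    match P, hlen with
    | p :: P, hlen =>
      obtain ⟨l, hl, hlc, hlm, hlh, hll⟩ := ih P (by simpa using hlen)
        (fun p hp ↦ hP p (by simp [hp])) (fun q hq ↦ hQ q (by simp [hq]))
      obtain ⟨hp1, hp2, hp3⟩ := hP p (by simp)
      obtain ⟨hq1, hq2, hq3⟩ := hQ q (by simp)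
      refine ⟨p ++ (q ++ l), by simp [hp1], ?_, ?_, ?_, ?_⟩
      · rw [List.isChain_append, List.isChain_append]
        refine ⟨hp2, ⟨hq2, hlc, fun x hx y hy ↦ ?_⟩, fun x hx y hy ↦ ?_⟩
        · exact (hAB y (hlh y hy) x (hq3 x (List.mem_of_mem_getLast? hx))).symm
        · rw [List.head?_append_of_ne_nil _ hq1] at hy
          exact hAB x (hp3 x (List.mem_of_mem_getLast? hx)) y (hq3 y (List.mem_of_mem_head? hy))
      · rw [← Multiset.coe_add, ← Multiset.coe_add, hlm, List.flatten_cons, List.flatten_cons,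
          ← Multiset.coe_add, ← Multiset.coe_add]
        abel
      · rw [List.head?_append_of_ne_nil _ hp1]
        exact fun x hx ↦ hp3 x (List.mem_of_mem_head? hx)
      · rw [List.getLast?_append_of_ne_nil _ (by simp [hl]), List.getLast?_append_of_ne_nil _ hl]
        exact hll

lemma IsPathCover.exists_join [DecidableEq V] {P : List (List V)}
    (hAB : ∀ x ∈ A, ∀ y ∈ B, G.Adj x y) (hd : Disjoint A B) (hP : G.IsPathCover A P)
    (hB : B.card < P.length) :
    ∃ Q, G.IsPathCover (A ∪ B) Q ∧ Q.length + B.card = P.length := by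
  obtain ⟨l, hl, hlc, hlm, -, -⟩ := exists_isChain_interleave hAB (B.toList.map ([·]))
    (P.take (B.card + 1)) (by simp; omega)
    (fun p hp ↦ have hp := List.mem_of_mem_take hp
      ⟨hP.ne_nil p hp, hP.isChain p hp, fun x hx ↦ hP.mem hp hx⟩) (by simp)
  refine ⟨l :: P.drop (B.card + 1), ⟨?_, ?_, ?_⟩, by simp; omega⟩
  · simp only [List.mem_cons, forall_eq_or_imp]
    exact ⟨hl, fun p hp ↦ hP.ne_nil p (List.mem_of_mem_drop hp)⟩
  · simp only [List.mem_cons, forall_eq_or_imp]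
    exact ⟨hlc, fun p hp ↦ hP.isChain p (List.mem_of_mem_drop hp)⟩
  · have hB' : ((B.toList.map ([·])).flatten : Multiset V) = B.val := by
      rw [← List.flatMap_def]
      simp
    have hP' : ((P.take (B.card + 1)).flatten + (P.drop (B.card + 1)).flatten : Multiset V)
        = A.val := by
      rw [← hP.coe_flatten, Multiset.coe_add, ← List.flatten_append, List.take_append_drop]
    rw [← Finset.disjUnion_eq_union _ _ hd, Finset.disjUnion_val, List.flatten_cons,
      ← Multiset.coe_add, hlm, hB', ← hP']
    abel

/-- If two completely joined sets are covered by the same number of paths, then these paths can be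
linked into a closed spanning tour. -/
lemma IsPathCover.exists_closed_isChain [DecidableEq V] {P Q : List (List V)}
    (hAB : ∀ x ∈ A, ∀ y ∈ B, G.Adj x y) (hd : Disjoint A B) (hP : G.IsPathCover A P)
    (hQ : G.IsPathCover B Q) (hPQ : P.length = Q.length) (hQ0 : Q ≠ []) :
    ∃ l : List V, l ≠ [] ∧ l.IsChain G.Adj ∧ (l : Multiset V) = (A ∪ B).val ∧
      ∀ x ∈ l.head?, ∀ y ∈ l.getLast?, G.Adj y x := by
  match Q, hQ0 with
  | q :: Q, _ =>
    obtain ⟨l, hl, hlc, hlm, hlh, hll⟩ := exists_isChain_interleave hAB Q P hPQ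
      (fun p hp ↦ ⟨hP.ne_nil p hp, hP.isChain p hp, fun x hx ↦ hP.mem hp hx⟩)
      (fun q hq ↦ have hq := List.mem_cons_of_mem _ hq
        ⟨hQ.ne_nil q hq, hQ.isChain q hq, fun x hx ↦ hQ.mem hq hx⟩)
    have hq := hQ.ne_nil q (by simp)
    have hqB : ∀ x ∈ q, x ∈ B := fun x hx ↦ hQ.mem (by simp) hx
    refine ⟨l ++ q, by simp [hl], ?_, ?_, ?_⟩
    · rw [List.isChain_append]
      exact ⟨hlc, hQ.isChain q (by simp),
        fun x hx y hy ↦ hAB x (hll x hx) y (hqB y (List.mem_of_mem_head? hy))⟩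
    · rw [← Multiset.coe_add, hlm, ← Finset.disjUnion_eq_union _ _ hd, Finset.disjUnion_val,
        ← hP.coe_flatten, ← hQ.coe_flatten, List.flatten_cons, ← Multiset.coe_add]
      abel
    · rw [List.head?_append_of_ne_nil _ hl, List.getLast?_append_of_ne_nil _ hq]
      exact fun x hx y hy ↦ (hAB x (hlh x hx) y (hqB y (List.mem_of_mem_getLast? hy))).symm

/-- Deleting `S ⊆ A` from the subgraph induced by `A` leaves at least `m` components: this is
witnessed by a labelling that is constant on components and takes at least `m` values. -/
def Scatters [DecidableEq V] (G : SimpleGraph V) (A S : Finset V) (m : ℕ) : Prop :=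
  S ⊆ A ∧ ∃ f : V → V, (∀ x ∈ A, f x ∈ A) ∧
    (∀ x ∈ A \ S, ∀ y ∈ A \ S, G.Adj x y → f x = f y) ∧ m ≤ ((A \ S).image f).card

namespace Scatters

variable [DecidableEq V] {m n : ℕ}

lemma empty_one (hA : A.Nonempty) : G.Scatters A ∅ 1 := by
  obtain ⟨a, ha⟩ := hA
  exact ⟨by simp, fun _ ↦ a, fun _ _ ↦ ha, fun _ _ _ _ _ ↦ rfl, Finset.card_pos.mpr
    ⟨a, Finset.mem_image.mpr ⟨a, by simpa using ha, rfl⟩⟩⟩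

lemma union (hA : G.Scatters A S m) (hB : G.Scatters B T n) (hd : Disjoint A B)
    (hAB : ∀ x ∈ A, ∀ y ∈ B, ¬ G.Adj x y) : G.Scatters (A ∪ B) (S ∪ T) (m + n) := by
  obtain ⟨hS, f, hf, hfadj, hfm⟩ := hA
  obtain ⟨hT, g, hg, hgadj, hgm⟩ := hB
  have hd' := Finset.disjoint_left.mp hd
  refine ⟨Finset.union_subset_union hS hT, fun x ↦ if x ∈ A then f x else g x, ?_, ?_, ?_⟩
  · grind
  · have := G.adj_comm
    grind
  · have hdi : Disjoint ((A \ S).image f) ((B \ T).image g) := by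
      rw [Finset.disjoint_left]
      grind
    refine (add_le_add hfm hgm).trans ?_
    rw [← Finset.card_union_of_disjoint hdi]
    refine Finset.card_le_card fun z hz ↦ ?_
    simp only [Finset.mem_union, Finset.mem_image] at hz ⊢
    obtain ⟨x, hx, rfl⟩ | ⟨x, hx, rfl⟩ := hz
    · exact ⟨x, by grind, by grind⟩
    · exact ⟨x, by grind, by grind⟩

lemma union_right (hA : G.Scatters A S m) (hd : Disjoint A B) :
    G.Scatters (A ∪ B) (S ∪ B) m := by
  obtain ⟨hS, f, hf, hfadj, hfm⟩ := hA
  have hd' := Finset.disjoint_left.mp hd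
  have hdiff : (A ∪ B) \ (S ∪ B) = A \ S := by grind
  refine ⟨Finset.union_subset_union hS le_rfl, fun x ↦ if x ∈ A then f x else x, ?_, ?_, ?_⟩
  · grind
  · grind
  · rw [hdiff]
    refine hfm.trans_eq (congrArg Finset.card (Finset.image_congr fun x hx ↦ ?_))
    have : x ∈ A := by grind
    simp [this]

end Scatters

lemma Separates.adj_of_compl [DecidableEq V] (h : Gᶜ.Separates A) :
    ∃ B C : Finset V, B.Nonempty ∧ C.Nonempty ∧ Disjoint B C ∧ B ∪ C = A ∧
      ∀ x ∈ B, ∀ y ∈ C, G.Adj x y := by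
  obtain ⟨B, C, hB, hC, hd, rfl, hBC⟩ := h
  refine ⟨B, C, hB, hC, hd, rfl, fun x hx y hy ↦ ?_⟩
  by_contra hxy
  exact hBC x hx y hy ⟨Finset.disjoint_left.mp hd |> fun h hxy ↦ h hx (hxy ▸ hy), hxy⟩

theorem PathsHaveChords.exists_isPathCover_scatters [DecidableEq V] (h : G.PathsHaveChords)
    (hA : A.Nonempty) :
    ∃ P S, G.IsPathCover A P ∧ G.Scatters A S (P.length + S.card) := by
  induction A using Finset.strongInduction with
  | H A ih =>
  obtain ⟨a, rfl⟩ | hA' := hA.exists_eq_singleton_or_nontrivial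
  · exact ⟨[[a]], ∅, ⟨by simp, by simp, by simp⟩, .empty_one hA⟩
  obtain hsep | hsep := h.separates_or_compl_separates hA'
  · obtain ⟨B, C, hB, hC, hd, rfl, hBC⟩ := hsep
    have hd' := Finset.disjoint_left.mp hd
    obtain ⟨P, S, hP, hS⟩ := ih B (by grind) hB
    obtain ⟨Q, T, hQ, hT⟩ := ih C (by grind) hC
    refine ⟨P ++ Q, S ∪ T, hP.append hQ hd, ?_⟩
    convert hS.union hT hd hBC using 1
    rw [Finset.card_union_of_disjoint (hd.mono hS.1 hT.1), List.length_append]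
    omega
  · obtain ⟨B, C, hB, hC, hd, rfl, hBC⟩ := hsep.adj_of_compl
    have hd' := Finset.disjoint_left.mp hd
    obtain ⟨P, S, hP, hS⟩ := ih B (by grind) hB
    obtain ⟨Q, T, hQ, hT⟩ := ih C (by grind) hC
    by_cases hCP : C.card < P.length
    · obtain ⟨R, hR, hRlen⟩ := hP.exists_join hBC hd hCP
      refine ⟨R, S ∪ C, hR, ?_⟩
      convert hS.union_right hd using 1
      rw [Finset.card_union_of_disjoint (hd.mono_left hS.1)]
      omega
    by_cases hBQ : B.card < Q.length
    · obtain ⟨R, hR, hRlen⟩ := hQ.exists_join (fun x hx y hy ↦ (hBC y hy x hx).symm) hd.symm hBQ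
      rw [Finset.union_comm]
      refine ⟨R, T ∪ B, hR, ?_⟩
      convert hT.union_right hd.symm using 1
      rw [Finset.card_union_of_disjoint (hd.symm.mono_left hT.1)]
      omega
    have := hP.length_le
    have := hQ.length_le
    obtain ⟨P', hP', hPlen⟩ := hP.exists_length_eq (le_max_left P.length Q.length) (by omega)
    obtain ⟨Q', hQ', hQlen⟩ := hQ.exists_length_eq (le_max_right P.length Q.length) (by omega)
    obtain ⟨l, hl, hlc, hlm, -⟩ := hP'.exists_closed_isChain hBC hd hQ' (by omega)
      (hQ'.ne_nil_of_nonempty hC)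
    exact ⟨[l], ∅, ⟨by simpa, by simpa, by rw [← hlm]; simp⟩, .empty_one hA⟩

end

lemma hasHamCycle_of_isChain [Fintype V] [DecidableEq V] {G : SimpleGraph V}
    (hcard : 3 ≤ Fintype.card V) {l : List V} (hl : l ≠ []) (hc : l.IsChain G.Adj)
    (hlm : (l : Multiset V) = Finset.univ.val)
    (hclose : ∀ x ∈ l.head?, ∀ y ∈ l.getLast?, G.Adj y x) : HasHamCycle G := by
  have hadj : G.Adj (l.getLast hl) (l.head hl) :=
    hclose _ (List.head_mem_head? hl) _ (List.getLast_mem_getLast? hl)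
  have hlen : l.length = Fintype.card V := by
    rw [← Multiset.coe_card, hlm, Finset.card_val, Finset.card_univ]
  have hnd : l.Nodup := by
    rw [← Multiset.coe_nodup, hlm]
    exact Finset.univ.nodup
  have hwlen : (Walk.cons hadj (Walk.ofSupport l hl hc)).length = Fintype.card V := by
    rw [Walk.length_cons, Walk.length_ofSupport]
    omega
  refine ⟨_, Walk.cons hadj (Walk.ofSupport l hl hc), ?_⟩
  rw [Walk.isHamiltonianCycle_iff_isCycle_and_length_eq,
    Walk.isCycle_iff_isPath_tail_and_le_length, hwlen]
  refine ⟨⟨?_, hcard⟩, rfl⟩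
  rw [Walk.isPath_def, Walk.support_tail_of_not_nil _ Walk.not_nil_cons, Walk.support_cons,
    List.tail_cons, Walk.support_ofSupport]
  exact hnd

end SimpleGraph

namespace IsCompOf

variable {G : SimpleGraph V} {S R R' : Set V}

lemma nonempty (h : IsCompOf G S R) : R.Nonempty :=
  Set.nonempty_coe_sort.mp h.2.1.nonempty

lemma eq_of_mem {x : V} (h : IsCompOf G S R) (h' : IsCompOf G S R') (hx : x ∈ R) (hx' : x ∈ R') :
    R = R' := by
  have hc := induce_union_connected h.2.1.preconnected h'.2.1.preconnected ⟨x, hx, hx'⟩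
  have hS := Set.union_subset h.1 h'.1
  exact (h.2.2 _ Set.subset_union_left hS hc).symm.trans
    (h'.2.2 _ Set.subset_union_right hS hc)

lemma mem_of_adj {x y : V} (h : IsCompOf G S R) (hx : x ∈ R) (hy : y ∉ R) (hxy : G.Adj x y) :
    y ∈ S := by
  by_contra hyS
  refine hy ?_
  have hc := induce_union_connected h.2.1.preconnected
    (induce_pair_connected_of_adj hxy).preconnected ⟨x, hx, by simp⟩
  rw [← h.2.2 _ Set.subset_union_left
    (Set.union_subset h.1 (Set.pair_subset_iff.mpr ⟨h.1 hx, hyS⟩)) hc]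
  simp

lemma apply_eq {f : V → V} (hf : ∀ x ∈ Sᶜ, ∀ y ∈ Sᶜ, G.Adj x y → f x = f y)
    (h : IsCompOf G S R) {x y : V} (hx : x ∈ R) (hy : y ∈ R) : f x = f y := by
  obtain ⟨w⟩ := h.2.1.preconnected ⟨x, hx⟩ ⟨y, hy⟩
  suffices ∀ a b : R, (G.induce R).Walk a b → f a = f b from this _ _ w
  intro a b w
  induction w with
  | nil => rfl
  | @cons a b c hab _ ih => exact (hf a (h.1 a.2) b (h.1 b.2) hab).trans ih

lemma exists_mem [Finite V] {x : V} (hx : x ∉ S) : ∃ R, IsCompOf G S R ∧ x ∈ R := by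
  obtain ⟨R, hxR, hR⟩ := Set.Finite.exists_le_maximal
    (Set.toFinite {R : Set V | R ⊆ Sᶜ ∧ (G.induce R).Connected}) (a := {x})
    ⟨by simpa using hx, by simp⟩
  refine ⟨R, ⟨hR.prop.1, hR.prop.2, fun R' hRR' hS hc ↦ ?_⟩, hxR rfl⟩
  exact (hR.eq_of_le ⟨hS, hc⟩ hRR').symm

end IsCompOf

lemma SimpleGraph.Scatters.le_numComp [Fintype V] [DecidableEq V] {G : SimpleGraph V}
    {S : Finset V} {m : ℕ} (h : G.Scatters Finset.univ S m) : m ≤ numComp G S := by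
  obtain ⟨-, f, -, hf, hm⟩ := h
  have hf' : ∀ x ∈ (S : Set V)ᶜ, ∀ y ∈ (S : Set V)ᶜ, G.Adj x y → f x = f y := by
    simpa using hf
  refine hm.trans ?_
  rw [← Set.ncard_coe_finset]
  have : ∀ z ∈ ((Finset.univ \ S).image f : Finset V), ∃ R, IsCompOf G S R ∧ ∃ x ∈ R, f x = z := by
    intro z hz
    obtain ⟨x, hx, rfl⟩ := Finset.mem_image.mp hz
    obtain ⟨R, hR, hxR⟩ := IsCompOf.exists_mem (G := G) (S := S) (x := x) (by simpa using hx)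
    exact ⟨R, hR, x, hxR, rfl⟩
  choose! g hg y hy hfy using this
  refine Set.ncard_le_ncard_of_injOn g (fun z hz ↦ hg z hz) (fun z hz z' hz' hzz' ↦ ?_)
    (Set.toFinite _)
  rw [← hfy z hz, ← hfy z' hz']
  exact (hg z hz).apply_eq hf' (hy z hz) (hzz' ▸ hy z' hz')

theorem SimpleGraph.Walk.IsHamiltonianCycle.tough [Finite V] [DecidableEq V] {G : SimpleGraph V}
    {v : V} {w : G.Walk v v} (hw : w.IsHamiltonianCycle) : Tough 1 G := by
  intro S hS
  rw [one_mul, Nat.cast_le]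
  have hexit : ∀ R, IsCompOf G S R → ∃ d ∈ w.darts, d.fst ∈ R ∧ d.snd ∉ R := by
    intro R hR
    obtain ⟨R', hR', hne⟩ := Set.exists_ne_of_one_lt_ncard (show 1 < numComp G S from hS) R
    obtain ⟨x, hx⟩ := hR.nonempty
    obtain ⟨y, hy⟩ := IsCompOf.nonempty hR'
    have hyR : y ∉ R := fun h ↦ hne (IsCompOf.eq_of_mem hR' hR hy h)
    by_cases hv : v ∈ R
    · obtain ⟨d, hd, h⟩ := (w.takeUntil y (hw.mem_support y)).exists_boundary_dart R hv hyR
      exact ⟨d, w.darts_takeUntil_subset_darts _ hd, h⟩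
    · obtain ⟨d, hd, h⟩ := (w.dropUntil x (hw.mem_support x)).exists_boundary_dart R hx hv
      exact ⟨d, w.darts_dropUntil_subset_darts _ hd, h⟩
  have hinj : ∀ d ∈ w.darts, ∀ d' ∈ w.darts, d.snd = d'.snd → d = d' := by
    refine fun d hd d' hd' ↦ List.inj_on_of_nodup_map (f := (·.snd)) ?_ hd hd'
    rw [Walk.map_snd_darts]
    exact hw.isCycle.support_nodup
  have : Nonempty G.Dart := by
    obtain ⟨R, hR⟩ := Set.nonempty_of_ncard_ne_zero (show numComp G S ≠ 0 by
      have : 2 ≤ numComp G S := hS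
      omega)
    exact ⟨(hexit R hR).choose⟩
  choose! e he hefst hesnd using hexit
  refine Set.ncard_le_ncard_of_injOn (fun R ↦ (e R).snd)
    (fun R hR ↦ IsCompOf.mem_of_adj hR (hefst R hR) (hesnd R hR) (e R).adj)
    (fun R hR R' hR' h ↦ ?_) (Set.toFinite _)
  have := hinj _ (he R hR) _ (he R' hR') h
  exact IsCompOf.eq_of_mem hR hR' (hefst R hR) (this ▸ hefst R' hR')

theorem Tough.hasHamCycle [Fintype V] [DecidableEq V] {G : SimpleGraph V} (hG : Tough 1 G)
    (hcard : 3 ≤ Fintype.card V) (hch : G.PathsHaveChords) : HasHamCycle G := by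
  have htough : ∀ (S : Finset V) (m : ℕ), G.Scatters Finset.univ S m → 2 ≤ m → m ≤ S.card := by
    intro S m hS hm
    have := hG S (hm.trans hS.le_numComp)
    rw [one_mul, Nat.cast_le, Set.ncard_coe_finset] at this
    exact hS.le_numComp.trans this
  have hnt : (Finset.univ : Finset V).Nontrivial := by
    rw [← Finset.one_lt_card_iff_nontrivial, Finset.card_univ]
    omega
  obtain hsep | hsep := hch.separates_or_compl_separates hnt
  · obtain ⟨B, C, hB, hC, hd, hBC, hno⟩ := hsep
    have := htough (∅ ∪ ∅) 2 (hBC ▸ (Scatters.empty_one hB).union (.empty_one hC) hd hno) le_rfl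
    simp at this
  obtain ⟨B, C, hB, hC, hd, hBC, hadj⟩ := hsep.adj_of_compl
  obtain ⟨P, S, hP, hS⟩ := hch.exists_isPathCover_scatters hB
  obtain ⟨Q, T, hQ, hT⟩ := hch.exists_isPathCover_scatters hC
  have hB' := hB.card_pos
  have hC' := hC.card_pos
  have hPC : P.length ≤ C.card := by
    by_contra! hlt
    have := htough _ _ (hBC ▸ hS.union_right hd) (by omega)
    rw [Finset.card_union_of_disjoint (hd.mono_left hS.1)] at this
    omega
  have hQB : Q.length ≤ B.card := by
    by_contra! hlt
    have := htough _ _ (hBC ▸ Finset.union_comm C B ▸ hT.union_right hd.symm) (by omega)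
    rw [Finset.card_union_of_disjoint (hd.symm.mono_left hT.1)] at this
    omega
  have := hP.length_le
  have := hQ.length_le
  obtain ⟨P', hP', hPlen⟩ := hP.exists_length_eq (le_max_left P.length Q.length) (by omega)
  obtain ⟨Q', hQ', hQlen⟩ := hQ.exists_length_eq (le_max_right P.length Q.length) (by omega)
  obtain ⟨l, hl, hlc, hlm, hclose⟩ := hP'.exists_closed_isChain hadj hd hQ' (by omega)
    (hQ'.ne_nil_of_nonempty hC)
  exact hasHamCycle_of_isChain hcard hl hlc (hBC ▸ hlm) hclose

/-- Jung. A `P₄`-free graph with at least three vertices is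
hamiltonian if and only if it is 1-tough. -/
theorem stmt_0 {V : Type*} [Fintype V] [DecidableEq V] (G : SimpleGraph V)
    (hcard : 3 ≤ Fintype.card V) (hP4 : P4Free G) :
    HasHamCycle G ↔ Tough 1 G := by
  exact ⟨fun ⟨_, _, hw⟩ ↦ hw.tough, fun h ↦ h.hasHamCycle hcard (.of_p4Free hP4)⟩
end

section
/- Let G be a P4-free simple graph with at least two vertices. Then the prism G □ K2 (the Cartesian product of G with the complete graph on two vertices) has a Hamiltonian cycle if and only if G is (1/2)-tough. -/
open SimpleGraph

variable {V : Type*} {W : Type*}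

section Components

variable {G : SimpleGraph V} {S R R' : Set V}

lemma exists_isCompOf [Finite V] {x : V} (hx : x ∉ S) : ∃ R, IsCompOf G S R ∧ x ∈ R := by
  obtain ⟨R, hxR, hR⟩ := (Set.toFinite {R : Set V | x ∈ R ∧ R ⊆ Sᶜ ∧
    (G.induce R).Connected}).exists_le_maximal (a := {x}) (by
      refine ⟨rfl, by simpa using hx, ?_⟩
      exact ⟨Preconnected.of_subsingleton⟩)
  refine ⟨R, ⟨hR.prop.2.1, hR.prop.2.2, fun R' h hS hc => ?_⟩, hR.prop.1⟩
  exact (hR.eq_of_le ⟨h hR.prop.1, hS, hc⟩ h).symm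

lemma IsCompOf.mem_of_adj_s2 (h : IsCompOf G S R) {x y : V} (hx : x ∈ R) (hy : y ∉ S)
    (hxy : G.Adj x y) : y ∈ R := by
  have hc := connected_induce_union h.2.1.preconnected
    (t := {y}) (Preconnected.of_subsingleton) hx rfl hxy
  rw [← h.2.2 _ Set.subset_union_left (Set.union_subset h.1 (by simpa using hy)) hc]
  simp

lemma IsCompOf.eq_of_mem_s2 (h : IsCompOf G S R) (h' : IsCompOf G S R') {x : V} (hx : x ∈ R)
    (hx' : x ∈ R') : R = R' := by
  have hc := induce_union_connected h.2.1.preconnected h'.2.1.preconnected ⟨x, hx, hx'⟩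
  have hs := Set.union_subset h.1 h'.1
  exact (h.2.2 _ Set.subset_union_left hs hc).symm.trans
    (h'.2.2 _ Set.subset_union_right hs hc)

/-- A function that is constant along the edges inside `R` is constant on `R` if `R` is connected. -/
lemma eq_of_connected_induce {C : Type*} {f : V → C} (hR : (G.induce R).Connected)
    (hf : ∀ x ∈ R, ∀ y ∈ R, G.Adj x y → f x = f y) {x y : V} (hx : x ∈ R) (hy : y ∈ R) :
    f x = f y := by
  obtain ⟨p⟩ := hR.preconnected ⟨x, hx⟩ ⟨y, hy⟩
  have key : ∀ (a b : R), (G.induce R).Walk a b → f a = f b := by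
    intro a b p
    induction p with
    | nil => rfl
    | cons h _ ih => exact (hf _ (Subtype.prop _) _ (Subtype.prop _) h).trans ih
  exact key _ _ p

/-- A colouring of `G - S` without bichromatic edges uses at most as many colours as there are
components. -/
lemma card_image_le_numComp [Fintype V] {C : Type*} [DecidableEq C] {T : Finset V} {f : V → C}
    (hT : ∀ x, x ∈ T ↔ x ∉ S) (hf : ∀ x ∈ T, ∀ y ∈ T, G.Adj x y → f x = f y) :
    (T.image f).card ≤ numComp G S := by
  classical
  have key : ∀ c ∈ T.image f, ∃ R, IsCompOf G S R ∧ ∀ x ∈ R, f x = c := by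
    intro c hc
    obtain ⟨x, hx, rfl⟩ := Finset.mem_image.1 hc
    obtain ⟨R, hR, hxR⟩ := exists_isCompOf (G := G) ((hT x).1 hx)
    refine ⟨R, hR, fun y hy => eq_of_connected_induce hR.2.1 ?_ hy hxR⟩
    exact fun a ha b hb => hf a ((hT a).2 (hR.1 ha)) b ((hT b).2 (hR.1 hb))
  choose! g hg hgf using key
  rw [← Set.ncard_coe_finset, numComp]
  refine Set.ncard_le_ncard_of_injOn g (fun c hc => hg c hc) (fun c hc d hd h => ?_)
    (Set.toFinite _)
  obtain ⟨x, hx⟩ := (hg c hc).2.1.nonempty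
  rw [← hgf c hc x hx, ← hgf d hd x (h ▸ hx)]

lemma prism_adj {p q : V × Fin 2} :
    (prism G).Adj p q ↔ (G.Adj p.1 q.1 ∧ p.2 = q.2) ∨ (p.2 ≠ q.2 ∧ p.1 = q.1) := by
  simp [prism, boxProd_adj]

lemma numComp_le_of_hasHamCycle_prism [Fintype V] [DecidableEq V]
    (h : HasHamCycle (prism G)) (hS : IsCutset G S) : numComp G S ≤ 2 * S.ncard := by
  obtain ⟨v, w, hw⟩ := h
  have key : ∀ R, IsCompOf G S R →
      ∃ i < w.length, (w.getVert i).1 ∈ R ∧ (w.getVert (i + 1)).1 ∈ S := by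
    intro R hR
    by_contra! hcon
    have hstep : ∀ i < w.length, (w.getVert i).1 ∈ R → (w.getVert (i + 1)).1 ∈ R := by
      intro i hi hiR
      rcases prism_adj.1 (w.adj_getVert_succ hi) with h | h
      · exact hR.mem_of_adj_s2 hiR (hcon i hi hiR) h.1
      · exact h.2 ▸ hiR
    have hmono : ∀ i j, i ≤ j → j ≤ w.length → (w.getVert i).1 ∈ R → (w.getVert j).1 ∈ R := by
      intro i j hij
      induction j, hij using Nat.le_induction with
      | base => exact fun _ h => h
      | succ j _ ih => exact fun hj h => hstep j hj (ih (by lia) h)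
    have hpos : ∀ p : V × Fin 2, ∃ i ≤ w.length, w.getVert i = p := by
      intro p
      obtain ⟨i, h1, h2⟩ := Walk.mem_support_iff_exists_getVert.1 (hw.mem_support p)
      exact ⟨i, h2, h1⟩
    obtain ⟨x, hx⟩ := hR.2.1.nonempty
    obtain ⟨i, hi, hix⟩ := hpos (x, 0)
    have h0 : (w.getVert 0).1 ∈ R := by
      have := hmono i _ hi le_rfl (by rwa [hix])
      simpa using this
    have hall : ∀ y, y ∈ R := by
      intro y
      obtain ⟨j, hj, hjy⟩ := hpos (y, 0)
      simpa [hjy] using hmono 0 j (Nat.zero_le _) hj h0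
    have hone : numComp G S ≤ 1 := by
      rw [numComp, Set.ncard_le_one (Set.toFinite _)]
      intro A hA B hB
      obtain ⟨a, ha⟩ := hA.2.1.nonempty
      obtain ⟨b, hb⟩ := hB.2.1.nonempty
      rw [hA.eq_of_mem_s2 hR ha (hall a), hB.eq_of_mem_s2 hR hb (hall b)]
    have : 2 ≤ numComp G S := hS
    lia
  choose! i hi hiR hiS using key
  have hcard : (S ×ˢ (Set.univ : Set (Fin 2))).ncard = 2 * S.ncard := by
    rw [Set.ncard_prod]; simp [mul_comm, Set.ncard_univ]
  rw [← hcard, numComp]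
  refine Set.ncard_le_ncard_of_injOn (fun R => w.getVert (i R + 1))
    (fun R hR => by simpa using hiS R hR) (fun R hR R' hR' h => ?_) (Set.toFinite _)
  have : i R + 1 = i R' + 1 :=
    hw.isCycle.getVert_injOn ⟨by lia, hi R hR⟩ ⟨by lia, hi R' hR'⟩ h
  refine hR.eq_of_mem_s2 hR' (hiR R hR) ?_
  rw [Nat.add_right_cancel this]
  exact hiR R' hR'

end Components

section Decomposition

/-- The elementwise form of being `P₄`-free. -/
def NoInducedPath (G : SimpleGraph V) : Prop :=
  ∀ a b c d, G.Adj a b → G.Adj b c → G.Adj c d → ¬ G.Adj a c → ¬ G.Adj b d → G.Adj a d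

lemma P4Free.noInducedPath {G : SimpleGraph V} (h : P4Free G) : NoInducedPath G := by
  intro a b c d hab hbc hcd hac hbd
  by_contra had
  have hne1 : a ≠ c := by rintro rfl; exact had hcd
  have hne2 : a ≠ d := by rintro rfl; exact hac hcd.symm
  have hne3 : b ≠ d := by rintro rfl; exact had hab
  refine h.false ⟨⟨![a, b, c, d], ?_⟩, ?_⟩
  · intro i j hij
    fin_cases i <;> fin_cases j <;>
      simp_all [hab.ne, hbc.ne, hcd.ne, hab.ne', hbc.ne', hcd.ne', hne1.symm, hne2.symm, hne3.symm]
  · intro i j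
    change G.Adj (![a, b, c, d] i) (![a, b, c, d] j) ↔ _
    fin_cases i <;> fin_cases j <;>
      simp [pathGraph_adj, hab, hbc, hcd, hac, hbd, had, G.adj_comm b a, G.adj_comm c b,
        G.adj_comm d c, G.adj_comm c a, G.adj_comm d b, G.adj_comm d a]

lemma NoInducedPath.compl {G : SimpleGraph V} (h : NoInducedPath G) : NoInducedPath Gᶜ := by
  intro a b c d hab hbc hcd hac hbd
  by_contra had
  have hne1 : a ≠ c := by rintro rfl; exact had hcd
  have hne2 : a ≠ d := by rintro rfl; exact hac hcd.symm
  have hne3 : b ≠ d := by rintro rfl; exact had hab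
  have := h b d a c
  simp_all [compl_adj, adj_comm]

variable [DecidableEq V]

/-- `H` splits into two nonempty parts with no edges between them. -/
def Splits (G : SimpleGraph V) (H : Finset V) : Prop :=
  ∃ A B : Finset V, A.Nonempty ∧ B.Nonempty ∧ Disjoint A B ∧ A ∪ B = H ∧
    ∀ a ∈ A, ∀ b ∈ B, ¬ G.Adj a b

lemma Splits.insert {G : SimpleGraph V} (hG : NoInducedPath G) {H : Finset V} {v : V}
    (hv : v ∉ H) (hH : Splits G H) : Splits G (insert v H) ∨ Splits Gᶜ (insert v H) := by
  classical
  by_cases hM : ∀ x ∈ H, G.Adj v x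
  · right
    obtain ⟨A, B, ⟨a, ha⟩, -, -, rfl, -⟩ := hH
    refine ⟨{v}, A ∪ B, by simp, ⟨a, by simp [ha]⟩, by simpa using hv, rfl, ?_⟩
    intro x hx b hb
    rw [Finset.mem_singleton.1 hx]
    simp [hM b hb]
  left
  push Not at hM
  have key : ∀ A B : Finset V, A.Nonempty → B.Nonempty → Disjoint A B → A ∪ B = H →
      (∀ a ∈ A, ∀ b ∈ B, ¬ G.Adj a b) → (∃ x ∈ A, ¬ G.Adj v x) → Splits G (Insert.insert v H) := by
    rintro A B hA hB hd rfl hAB ⟨x, hxA, hx⟩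
    by_cases hw : ∃ w ∈ B, G.Adj v w
    · obtain ⟨w, hwB, hw⟩ := hw
      refine ⟨A.filter (¬ G.Adj v ·), Insert.insert v (A.filter (G.Adj v ·) ∪ B),
        ⟨x, by simp [hxA, hx]⟩, by simp, ?_, ?_, ?_⟩
      · rw [Finset.disjoint_left] at hd ⊢
        simp only [Finset.mem_filter, Finset.mem_insert, Finset.mem_union, not_or]
        rintro a ⟨ha, hva⟩
        exact ⟨by rintro rfl; exact hv (by simp [ha]), by simp [hva], hd ha⟩
      · ext y
        simp only [Finset.mem_filter, Finset.mem_insert, Finset.mem_union]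
        tauto
      · simp only [Finset.mem_filter, Finset.mem_insert, Finset.mem_union]
        rintro a ⟨ha, hva⟩ b (rfl | ⟨hb, hvb⟩ | hb) hab
        · exact hva hab.symm
        · exact hAB a ha w hwB
            (hG a b v w hab hvb.symm hw (fun h => hva h.symm) (hAB b hb w hwB))
        · exact hAB a ha b hb hab
    · push Not at hw
      refine ⟨Insert.insert v A, B, by simp, hB, ?_, by rw [Finset.insert_union], ?_⟩
      · rw [Finset.disjoint_insert_left]
        exact ⟨fun h => hv (by simp [h]), hd⟩
      · intro a ha b hb
        rcases Finset.mem_insert.1 ha with rfl | ha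
        · exact hw b hb
        · exact hAB a ha b hb
  obtain ⟨A, B, hA, hB, hd, rfl, hAB⟩ := hH
  obtain ⟨x, hx, hvx⟩ := hM
  rcases Finset.mem_union.1 hx with hx | hx
  · exact key A B hA hB hd rfl hAB ⟨x, hx, hvx⟩
  · exact key B A hB hA hd.symm (Finset.union_comm _ _)
      (fun b hb a ha h => hAB a ha b hb h.symm) ⟨x, hx, hvx⟩

lemma splits_or_splits_compl {G : SimpleGraph V} (hG : NoInducedPath G) (H : Finset V)
    (hH : 2 ≤ H.card) : Splits G H ∨ Splits Gᶜ H := by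
  induction H using Finset.induction_on with
  | empty => simp at hH
  | insert v H hv ih =>
    by_cases h2 : 2 ≤ H.card
    · rcases ih h2 with h | h
      · exact h.insert hG hv
      · have := h.insert hG.compl hv
        rwa [compl_compl, or_comm] at this
    · rw [Finset.card_insert_of_notMem hv] at hH
      obtain ⟨x, rfl⟩ := Finset.card_eq_one.1 (show H.card = 1 by lia)
      have hd : Disjoint ({v} : Finset V) {x} := by simpa using hv
      by_cases hvx : G.Adj v x
      · exact Or.inr ⟨{v}, {x}, by simp, by simp, hd, rfl, by simp [hvx]⟩
      · exact Or.inl ⟨{v}, {x}, by simp, by simp, hd, rfl, by simp [hvx]⟩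

end Decomposition

section PathCovers

/-- The list `L` enumerates the vertices of the prism over `T` without repetition. -/
def Enumerates (L : List (V × Fin 2)) (T : Finset V) : Prop :=
  L.Nodup ∧ ∀ p, p ∈ L ↔ p.1 ∈ T

/-- `P` is a path of the prism that leads from the lower level to the upper level and whose ends
lie over `A`. -/
def IsRisingPath (G : SimpleGraph V) (A : Finset V) (P : List (V × Fin 2)) : Prop :=
  P.IsChain (prism G).Adj ∧ (∃ x ∈ A, P.head? = some (x, 0)) ∧ ∃ y ∈ A, P.getLast? = some (y, 1)

/-- The prism over `T` is covered by `k` disjoint rising paths with ends over `A`. -/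
def RisingCover (G : SimpleGraph V) (A T : Finset V) (k : ℕ) : Prop :=
  ∃ Ls : List (List (V × Fin 2)), Ls.length = k ∧ (∀ P ∈ Ls, IsRisingPath G A P) ∧
    Enumerates Ls.flatten T

/-- The prism over `T` has a Hamiltonian path joining the two copies of a vertex. -/
def VerticalHamPath (G : SimpleGraph V) (T : Finset V) : Prop :=
  ∃ (L : List (V × Fin 2)) (u : V), L.IsChain (prism G).Adj ∧ L.head? = some (u, 0) ∧
    L.getLast? = some (u, 1) ∧ Enumerates L T

variable {G : SimpleGraph V} {A T : Finset V} {k : ℕ} {b : V}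

lemma prism_adj_horizontal {x y : V} (i : Fin 2) (h : G.Adj x y) : (prism G).Adj (x, i) (y, i) :=
  prism_adj.2 (Or.inl ⟨h, rfl⟩)

lemma prism_adj_vertical (x : V) {i j : Fin 2} (h : i ≠ j) : (prism G).Adj (x, i) (x, j) :=
  prism_adj.2 (Or.inr ⟨h, rfl⟩)

lemma isChain_prism_reverse {L : List (V × Fin 2)} :
    L.reverse.IsChain (prism G).Adj ↔ L.IsChain (prism G).Adj := by
  rw [List.isChain_reverse]
  exact ⟨fun h => h.imp fun _ _ h => h.symm, fun h => h.imp fun _ _ h => h.symm⟩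

lemma risingCover_singleton (G : SimpleGraph V) (v : V) : RisingCover G {v} {v} 1 := by
  refine ⟨[[(v, 0), (v, 1)]], rfl, ?_, by simp, ?_⟩
  · simp [IsRisingPath, prism_adj]
  · rintro ⟨x, i⟩
    fin_cases i <;> simp

lemma VerticalHamPath.risingCover (h : VerticalHamPath G T) : RisingCover G T T 1 := by
  obtain ⟨L, u, hc, h0, h1, hL⟩ := h
  have hu : u ∈ T := (hL.2 (u, 0)).1 (List.mem_of_mem_head? h0)
  refine ⟨[L], rfl, ?_, by simpa using hL⟩
  simpa [IsRisingPath, hc, h0, h1] using hu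

lemma RisingCover.mono {A' : Finset V} (h : RisingCover G A T k) (hA : A ⊆ A') :
    RisingCover G A' T k := by
  obtain ⟨Ls, hk, hLs, hcov⟩ := h
  refine ⟨Ls, hk, fun P hP => ?_, hcov⟩
  obtain ⟨hc, ⟨x, hx, hx'⟩, y, hy, hy'⟩ := hLs P hP
  exact ⟨hc, ⟨x, hA hx, hx'⟩, y, hA hy, hy'⟩

lemma exists_vertical_step {L : List (V × Fin 2)} (hc : L.IsChain (prism G).Adj) {x y : V}
    (h0 : L.head? = some (x, 0)) (h1 : L.getLast? = some (y, 1)) :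
    ∃ l₁ u l₂, L = l₁ ++ (u, 0) :: (u, 1) :: l₂ := by
  induction L generalizing x with
  | nil => simp at h0
  | cons p L ih =>
    obtain rfl : p = (x, 0) := by simpa using h0
    match L with
    | [] => simp at h1
    | (z, i) :: L =>
      rw [List.isChain_cons_cons, prism_adj] at hc
      rcases hc.1 with h | h
      · obtain ⟨l₁, u, l₂, h⟩ := ih hc.2 (x := z) (by simp [show i = 0 from h.2.symm]) (by simpa using h1)
        exact ⟨(x, 0) :: l₁, u, l₂, by simp [h]⟩
      · obtain rfl : i = 1 := by have := h.1; dsimp at this; lia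
        obtain rfl : x = z := h.2
        exact ⟨[], x, L, rfl⟩

/-- If no occurrence of `p` is last and occurrences of `p` outnumber those of `q`, then some
element satisfying `p` is followed by one that does not satisfy `q`. -/
lemma exists_step_of_countP_lt {α : Type*} {p q : α → Bool} {L : List α}
    (hlast : ∀ x ∈ L.getLast?, ¬ p x) (h : L.tail.countP q < L.countP p) :
    ∃ l₁ x y l₂, L = l₁ ++ x :: y :: l₂ ∧ p x ∧ ¬ q y := by
  induction L with
  | nil => simp at h
  | cons x L ih =>
    match L with
    | [] => simp_all
    | y :: L =>
      by_cases hxy : p x ∧ ¬ q y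
      · exact ⟨[], x, y, L, rfl, hxy⟩
      · obtain ⟨l₁, x', y', l₂, h, h'⟩ := ih (by simpa using hlast) (by
          simp only [List.tail_cons, List.countP_cons] at h ⊢
          grind)
        exact ⟨x :: l₁, x', y', l₂, by simp [h], h'⟩

lemma List.IsChain.insert_step {α : Type*} {R : α → α → Prop} {l₁ l₂ : List α} {x y z : α}
    (h : (l₁ ++ x :: y :: l₂).IsChain R) (hxz : R x z) (hzy : R z y) :
    (l₁ ++ x :: z :: y :: l₂).IsChain R := by
  simp_all [List.isChain_append_cons_cons]

lemma head?_insert_step {α : Type*} (l₁ l₂ l₃ : List α) (x : α) :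
    (l₁ ++ x :: l₂).head? = (l₁ ++ x :: l₃).head? := by
  cases l₁ <;> simp

variable [DecidableEq V]

lemma Enumerates.insert {L L' : List (V × Fin 2)} (h : Enumerates L T) (hb : b ∉ T)
    (hp : L'.Perm ((b, 0) :: (b, 1) :: L)) : Enumerates L' (insert b T) := by
  constructor
  · rw [hp.nodup_iff]
    simp [h.1, h.2, hb]
  · rintro ⟨x, i⟩
    rw [hp.mem_iff]
    fin_cases i <;> simp [h.2]

lemma RisingCover.union {A' T' : Finset V} {k' : ℕ} (h : RisingCover G A T k)
    (h' : RisingCover G A' T' k') (hd : Disjoint T T') :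
    RisingCover G (A ∪ A') (T ∪ T') (k + k') := by
  obtain ⟨Ls, rfl, hLs, hn, hm⟩ := h.mono (A' := A ∪ A') Finset.subset_union_left
  obtain ⟨Ls', rfl, hLs', hn', hm'⟩ := h'.mono (A' := A ∪ A') Finset.subset_union_right
  refine ⟨Ls ++ Ls', by simp, ?_, ?_, ?_⟩
  · intro P hP
    rcases List.mem_append.1 hP with hP | hP
    · exact hLs P hP
    · exact hLs' P hP
  · rw [List.flatten_append]
    refine hn.append hn' fun p hp hp' => ?_
    exact Finset.disjoint_left.1 hd ((hm p).1 hp) ((hm' p).1 hp')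
  · intro p
    simp [List.flatten_append, -List.mem_flatten, hm, hm']

lemma RisingCover.merge (h : RisingCover G A T (k + 3)) (hb : b ∉ T) (hbA : ∀ a ∈ A, G.Adj a b) :
    RisingCover G A (insert b T) (k + 1) := by
  obtain ⟨Ls, hk, hLs, hcov⟩ := h
  match Ls, hk with
  | P :: Q :: R :: Ls, hk =>
    obtain ⟨hP, ⟨x, hx, hx'⟩, y, hy, hy'⟩ := hLs P (by simp)
    obtain ⟨hQ, ⟨z, hz, hz'⟩, w, hw, hw'⟩ := hLs Q (by simp)
    obtain ⟨hR, ⟨s, hs, hs'⟩, t, ht, ht'⟩ := hLs R (by simp)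
    refine ⟨(P ++ (b, 1) :: (Q.reverse ++ (b, 0) :: R)) :: Ls, by simpa using hk, ?_, ?_⟩
    · intro X hX
      rcases List.mem_cons.1 hX with rfl | hX
      · refine ⟨?_, ⟨x, hx, by simp [hx']⟩, t, ht,
          by simp [List.getLast?_append, List.getLast?_cons, ht']⟩
        simp only [List.isChain_append, List.isChain_cons, isChain_prism_reverse]
        simp [hP, hQ, hR, hy', hz', hw', hs', prism_adj, hbA _ hy, (hbA _ hw).symm, hbA _ hz,
          (hbA _ hs).symm]
      · exact hLs X (by simp [hX])
    · refine hcov.insert hb ?_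
      rw [List.perm_iff_count]
      intro p
      simp [List.count_cons]
      lia

lemma RisingCover.mergeAll {B : Finset V} (h : RisingCover G A T (2 * B.card + k + 1))
    (hB : Disjoint B T) (hAB : ∀ a ∈ A, ∀ b ∈ B, G.Adj a b) :
    RisingCover G A (B ∪ T) (k + 1) := by
  induction B using Finset.induction_on generalizing k with
  | empty => simpa using h
  | insert b B hb ih =>
    rw [Finset.disjoint_insert_left] at hB
    rw [Finset.card_insert_of_notMem hb] at h
    rw [Finset.insert_union]
    refine RisingCover.merge (ih (k := k + 2) (by convert h using 1; lia) hB.2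
      fun a ha c hc => hAB a ha c (by simp [hc])) (by simp [hb, hB.1])
      fun a ha => hAB a ha b (by simp)

lemma RisingCover.verticalHamPath_insert (h : RisingCover G A T k) (hk : k = 1 ∨ k = 2)
    (hb : b ∉ T) (hbA : ∀ a ∈ A, G.Adj a b) : VerticalHamPath G (insert b T) := by
  obtain ⟨Ls, rfl, hLs, hcov⟩ := h
  match Ls, hk with
  | [P], _ =>
    obtain ⟨hP, ⟨x, hx, hx'⟩, y, hy, hy'⟩ := hLs P (by simp)
    refine ⟨(b, 0) :: (P ++ [(b, 1)]), b, ?_, by simp,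
      by simp [List.getLast?_append, List.getLast?_cons], hcov.insert hb ?_⟩
    · simp only [List.isChain_append, List.isChain_cons]
      simp [hP, hx', hy', prism_adj, hbA _ hy, (hbA _ hx).symm]
    · rw [List.perm_iff_count]
      intro p
      simp [List.count_cons]
  | [P, Q], _ =>
    obtain ⟨hP, ⟨x, hx, hx'⟩, y, hy, hy'⟩ := hLs P (by simp)
    obtain ⟨hQ, ⟨z, hz, hz'⟩, w, hw, hw'⟩ := hLs Q (by simp)
    obtain ⟨l₁, u, l₂, rfl⟩ := exists_vertical_step hP hx' hy'
    refine ⟨(l₁ ++ [(u, 0)]).reverse ++ (b, 0) :: (Q ++ (b, 1) :: ((u, 1) :: l₂).reverse), u,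
      ?_, by simp, by simp [List.getLast?_append, List.getLast?_cons], hcov.insert hb ?_⟩
    · rw [List.isChain_append_cons_cons] at hP
      have h1 : (l₁ ++ [(u, 0)]).head? = some (x, 0) := by simpa using hx'
      have h2 : ((u, 1) :: l₂).getLast? = some (y, 1) := by simpa using hy'
      rw [List.isChain_append, List.isChain_cons, List.isChain_append, List.isChain_cons,
        isChain_prism_reverse, isChain_prism_reverse, List.getLast?_reverse, List.head?_reverse,
        h1, h2]
      simp [hP.1, hP.2.2, hQ, hz', hw', prism_adj, hbA _ hx, (hbA _ hz).symm, hbA _ hw,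
        (hbA _ hy).symm]
    · rw [List.perm_iff_count]
      intro p
      simp [List.count_cons]
      lia

/-- On a path of the prism that has no vertical step over `A`, some step stays inside `A` on
level `i`, provided that the remaining vertices on that level are fewer than those of `A`. -/
lemma exists_horizontal_step {L : List (V × Fin 2)} {A B : Finset V} (i : Fin 2)
    (hc : L.IsChain fun p q => (prism G).Adj p q ∧ ¬ (p.1 = q.1 ∧ p.1 ∈ A)) (hn : L.Nodup)
    (hA : ∀ a ∈ A, (a, i) ∈ L) (hL : ∀ y, (y, i) ∈ L → y ∈ A ∪ B) (hcard : B.card < A.card)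
    (hlast : ∀ x ∈ L.getLast?, x.1 ∉ A) :
    ∃ l₁ a a' l₂, L = l₁ ++ (a, i) :: (a', i) :: l₂ ∧ a ∈ A ∧ a' ∈ A := by
  have hcount : ∀ (l : List (V × Fin 2)) (C : Finset V),
      l.countP (fun p => p.2 = i ∧ p.1 ∈ C) = (l.filter (fun p => p.2 = i ∧ p.1 ∈ C)).length :=
    fun l C => List.countP_eq_length_filter
  have hinj : Function.Injective fun a : V => (a, i) := fun a a' h => congrArg Prod.fst h
  have h1 : A.card ≤ L.countP (fun p => p.2 = i ∧ p.1 ∈ A) := by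
    rw [hcount, ← Finset.card_map ⟨_, hinj⟩]
    refine (Finset.card_le_card (t := (L.filter _).toFinset) ?_).trans (List.toFinset_card_le _)
    intro p hp
    obtain ⟨a, ha, rfl⟩ := Finset.mem_map.1 hp
    simp [ha, hA a ha]
  have h2 : L.tail.countP (fun p => p.2 = i ∧ p.1 ∈ B) ≤ B.card := by
    rw [hcount, ← Finset.card_map ⟨_, hinj⟩,
      ← List.toFinset_card_of_nodup ((hn.sublist (List.tail_sublist L)).filter _)]
    refine Finset.card_le_card fun p hp => ?_
    obtain ⟨x, j⟩ := p
    simp only [List.mem_toFinset, List.mem_filter, decide_eq_true_eq] at hp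
    obtain ⟨-, rfl, hx⟩ := hp
    simpa using hx
  obtain ⟨l₁, ⟨a, j⟩, ⟨a', j'⟩, l₂, rfl, hp, hq⟩ := exists_step_of_countP_lt (L := L)
    (p := fun p => p.2 = i ∧ p.1 ∈ A) (q := fun p => p.2 = i ∧ p.1 ∈ B)
    (fun x hx h => hlast x hx (by simp at h; exact h.2)) (by lia)
  simp only [decide_eq_true_eq, not_and] at hp hq
  obtain ⟨rfl, ha⟩ := hp
  obtain ⟨hadj, hne⟩ := (List.isChain_append_cons_cons.1 hc).2.1
  rcases prism_adj.1 hadj with h | h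
  · obtain rfl : j = j' := h.2
    refine ⟨l₁, a, a', l₂, rfl, ha, ?_⟩
    have := hL a' (by simp)
    exact (Finset.mem_union.1 this).resolve_right (hq rfl)
  · exact absurd ⟨h.2, ha⟩ hne

lemma VerticalHamPath.insert {B : Finset V} (h : VerticalHamPath G (B ∪ A))
    (hcard : B.card < A.card) (hb : b ∉ B ∪ A) (hbA : ∀ a ∈ A, G.Adj a b) :
    VerticalHamPath G (insert b (B ∪ A)) := by
  obtain ⟨L, u, hc, h0, h1, hL⟩ := h
  by_cases hu : u ∈ A
  · refine ⟨(b, 0) :: (L ++ [(b, 1)]), b, ?_, by simp,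
      by simp [List.getLast?_append, List.getLast?_cons], hL.insert hb ?_⟩
    · simp only [List.isChain_append, List.isChain_cons]
      simp [hc, h0, h1, prism_adj, hbA _ hu, (hbA _ hu).symm]
    · rw [List.perm_iff_count]
      intro p
      simp [List.count_cons]
  by_cases hR : L.IsChain fun p q => (prism G).Adj p q ∧ ¬ (p.1 = q.1 ∧ p.1 ∈ A)
  · have hbA' : b ∉ A := fun h => hb (by simp [h])
    have hstep : ∀ (i : Fin 2), ∀ a ∈ A,
        ((prism G).Adj (a, i) (b, i) ∧ ¬ (a = b ∧ a ∈ A)) ∧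
        ((prism G).Adj (b, i) (a, i) ∧ ¬ (b = a ∧ b ∈ A)) := by
      intro i a ha
      refine ⟨⟨prism_adj_horizontal i (hbA a ha), ?_⟩,
        prism_adj_horizontal i (hbA a ha).symm, fun h => hbA' h.2⟩
      rintro ⟨rfl, h⟩
      exact hbA' h
    obtain ⟨l₁, a, a', l₂, rfl, ha, ha'⟩ := exists_horizontal_step 0 hR hL.1
      (fun a ha => (hL.2 _).2 (by simp [ha]))
      (fun y hy => by simpa [or_comm] using (hL.2 _).1 hy) hcard (by simp [h1, hu])
    have hlast : (l₁ ++ (a, 0) :: (b, 0) :: (a', 0) :: l₂).getLast? = some (u, 1) := by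
      simpa [List.getLast?_append] using h1
    have hmem : ∀ y, (y, 1) ∈ l₁ ++ (a, 0) :: (b, 0) :: (a', 0) :: l₂ ↔ y ∈ B ∪ A := by
      intro y
      rw [← hL.2 (y, 1)]
      simp
    obtain ⟨m₁, c, c', m₂, hm, hc, hc'⟩ := exists_horizontal_step 1
      (hR.insert_step (hstep 0 a ha).1 (hstep 0 a' ha').2)
      (by
        have hp : (l₁ ++ (a, 0) :: (b, 0) :: (a', 0) :: l₂).Perm
            ((b, 0) :: (l₁ ++ (a, 0) :: (a', 0) :: l₂)) := by
          rw [List.perm_iff_count]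
          intro p
          simp [List.count_cons]
          lia
        rw [hp.nodup_iff, List.nodup_cons]
        exact ⟨fun h => hb ((hL.2 _).1 h), hL.1⟩)
      (fun a ha => (hmem a).2 (by simp [ha]))
      (fun y hy => by simpa [or_comm] using (hmem y).1 hy) hcard (by simp [hlast, hu])
    have hchain := hR.insert_step (hstep 0 a ha).1 (hstep 0 a' ha').2
    rw [hm] at hchain hlast
    refine ⟨m₁ ++ (c, 1) :: (b, 1) :: (c', 1) :: m₂, u,
      (hchain.insert_step (hstep 1 c hc).1 (hstep 1 c' hc').2).imp fun _ _ h => h.1, ?_, ?_,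
      hL.insert hb ?_⟩
    · rw [head?_insert_step _ _ ((c', 1) :: m₂), ← hm, ← h0]
      exact head?_insert_step ..
    · rw [← hlast]
      simp [List.getLast?_append]
    · rw [List.perm_iff_count]
      intro p
      have := congrArg (List.count p) hm
      simp [List.count_cons] at this ⊢
      lia
  · have : ∃ p q l₁ l₂, L = l₁ ++ p :: q :: l₂ ∧ p.1 = q.1 ∧ p.1 ∈ A := by
      by_contra! hcon
      refine hR (List.isChain_iff_forall_rel_of_append_cons_cons.2 fun p q l₁ l₂ h => ?_)
      exact ⟨List.isChain_iff_forall_rel_of_append_cons_cons.1 hc h,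
        fun h' => hcon p q l₁ l₂ h h'.1 h'.2⟩
    obtain ⟨⟨a, i⟩, ⟨a', j⟩, l₁, l₂, rfl, rfl : a = a', ha⟩ := this
    have hij : i ≠ j := by
      rintro rfl
      exact (List.isChain_append_cons_cons.1 hc).2.1.ne rfl
    refine ⟨l₁ ++ (a, i) :: (b, i) :: (b, j) :: (a, j) :: l₂, u, ?_, ?_, ?_, hL.insert hb ?_⟩
    · rw [List.isChain_append_cons_cons] at hc ⊢
      simp only [List.isChain_cons_cons]
      exact ⟨hc.1, prism_adj_horizontal i (hbA a ha), prism_adj_vertical b hij,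
        prism_adj_horizontal j (hbA a ha).symm, hc.2.2⟩
    · rw [← h0]
      exact head?_insert_step ..
    · rw [← h1]
      simp [List.getLast?_append]
    · rw [List.perm_iff_count]
      intro p
      have : (i = 0 ∧ j = 1) ∨ (i = 1 ∧ j = 0) := by lia
      rcases this with ⟨rfl, rfl⟩ | ⟨rfl, rfl⟩ <;> simp [List.count_cons] <;> lia

lemma VerticalHamPath.insertAll {B C : Finset V} (h : VerticalHamPath G (B ∪ A))
    (hCB : Disjoint C (B ∪ A)) (hcard : C.card + B.card ≤ A.card)
    (hCA : ∀ a ∈ A, ∀ c ∈ C, G.Adj a c) : VerticalHamPath G (C ∪ (B ∪ A)) := by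
  induction C using Finset.induction_on with
  | empty => simpa using h
  | insert c C hc ih =>
    rw [Finset.disjoint_insert_left] at hCB
    rw [Finset.card_insert_of_notMem hc] at hcard
    have h' := ih hCB.2 (by lia) fun a ha d hd => hCA a ha d (by simp [hd])
    rw [← Finset.union_assoc] at h'
    rw [Finset.insert_union, ← Finset.union_assoc]
    have := Finset.card_union_le C B
    refine h'.insert (by lia) ?_ fun a ha => hCA a ha c (by simp)
    rw [Finset.union_assoc, Finset.mem_union, not_or]
    exact ⟨hc, hCB.1⟩

/-- Covering a join whose larger side `A` is covered by at most twice as many rising paths as the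
smaller side `B` has vertices. -/
lemma RisingCover.verticalHamPath {B : Finset V} (h : RisingCover G A A (k + 1))
    (hk : k + 1 ≤ 2 * B.card) (hd : Disjoint B A) (hcard : B.card ≤ A.card)
    (hAB : ∀ a ∈ A, ∀ b ∈ B, G.Adj a b) : VerticalHamPath G (B ∪ A) := by
  obtain ⟨C, hCB, hC⟩ := Finset.exists_subset_card_eq (show k / 2 ≤ B.card by lia)
  have h1 : RisingCover G A (C ∪ A) (k % 2 + 1) := by
    refine RisingCover.mergeAll (by convert h using 1; lia) (hd.mono_left hCB)
      fun a ha c hc => hAB a ha c (hCB hc)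
  obtain ⟨b, hbB, hbC⟩ := Finset.exists_mem_notMem_of_card_lt_card (show C.card < B.card by lia)
  have hbA : b ∉ A := Finset.disjoint_left.1 hd hbB
  have h2 := h1.verticalHamPath_insert (b := b) (by lia) (by simp [hbC, hbA])
    fun a ha => hAB a ha b hbB
  rw [← Finset.insert_union] at h2
  have hsub : Insert.insert b C ⊆ B := by simp [Finset.insert_subset_iff, hbB, hCB]
  have h3 := h2.insertAll (C := B \ Insert.insert b C) ?_ ?_ ?_
  · rwa [← Finset.union_assoc, Finset.sdiff_union_of_subset hsub] at h3
  · rw [Finset.disjoint_union_right]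
    exact ⟨Finset.sdiff_disjoint, hd.mono_left Finset.sdiff_subset⟩
  · rwa [Finset.card_sdiff_add_card_eq_card hsub]
  · exact fun a ha c hc => hAB a ha c (Finset.sdiff_subset hc)

lemma VerticalHamPath.hasHamCycle [Fintype V] (hV : 2 ≤ Fintype.card V)
    (h : VerticalHamPath G Finset.univ) : HasHamCycle (prism G) := by
  obtain ⟨L, u, hc, h0, h1, hn, hm⟩ := h
  have hne : L ≠ [] := by rintro rfl; simp at h0
  have hu0 : L.head hne = (u, 0) := by simpa [List.head?_eq_some_head hne] using h0
  have hu1 : L.getLast hne = (u, 1) := by simpa [List.getLast?_eq_some_getLast hne] using h1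
  have hadj : (prism G).Adj (L.getLast hne) (L.head hne) := by
    rw [hu0, hu1]
    exact prism_adj_vertical u (by decide)
  have hham : (Walk.ofSupport L hne hc).IsHamiltonian := by
    refine Walk.IsPath.isHamiltonian_of_mem (Walk.IsPath.mk' ?_) ?_
    · rwa [Walk.support_ofSupport]
    · intro p
      rw [Walk.support_ofSupport, hm]
      simp
  refine ⟨_, Walk.cons hadj (Walk.ofSupport L hne hc), ?_⟩
  rw [Walk.isHamiltonianCycle_iff_isCycle_and_support_count_tail_eq_one]
  refine ⟨Walk.isCycle_iff_isPath_tail_and_le_length.2 ⟨?_, ?_⟩, ?_⟩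
  · simpa using hham.isPath
  · rw [Walk.length_cons, hham.length_eq, Fintype.card_prod, Fintype.card_fin]
    lia
  · exact hham

end PathCovers

section Scattering

variable [DecidableEq V] {G : SimpleGraph V}

/-- Removing `H \ T` from `G[H]` leaves at least `k + 2 |H \ T|` components, as witnessed by a
colouring of `T` without bichromatic edges. -/
def IsScattered (G : SimpleGraph V) (H T : Finset V) (k : ℕ) : Prop :=
  T ⊆ H ∧ ∃ f : V → ℕ, (∀ x ∈ T, ∀ y ∈ T, G.Adj x y → f x = f y) ∧
    k + 2 * (H \ T).card ≤ (T.image f).card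

lemma isScattered_self {H : Finset V} (hH : H.Nonempty) : IsScattered G H H 1 := by
  refine ⟨subset_rfl, fun _ => 0, fun _ _ _ _ _ => rfl, ?_⟩
  simp [Finset.image_const hH]

lemma IsScattered.union {H H' T T' : Finset V} {k k' : ℕ} (h : IsScattered G H T k)
    (h' : IsScattered G H' T' k') (hd : Disjoint H H') (hG : ∀ a ∈ H, ∀ b ∈ H', ¬ G.Adj a b) :
    IsScattered G (H ∪ H') (T ∪ T') (k + k') := by
  obtain ⟨hT, f, hf, hk⟩ := h
  obtain ⟨hT', f', hf', hk'⟩ := h'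
  have hnot : ∀ x ∈ T', x ∉ T := fun x hx hx' => Finset.disjoint_left.1 hd (hT hx') (hT' hx)
  refine ⟨Finset.union_subset_union hT hT', fun x => if x ∈ T then 2 * f x else 2 * f' x + 1,
    ?_, ?_⟩
  · intro x hx y hy hxy
    rcases Finset.mem_union.1 hx with hx | hx <;> rcases Finset.mem_union.1 hy with hy | hy
    · simp [hx, hy, hf x hx y hy hxy]
    · exact absurd hxy (hG x (hT hx) y (hT' hy))
    · exact absurd hxy.symm (hG y (hT hy) x (hT' hx))
    · simp [hnot x hx, hnot y hy, hf' x hx y hy hxy]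
  · have h1 : T.image (fun x => if x ∈ T then 2 * f x else 2 * f' x + 1)
        = (T.image f).image (2 * ·) := by
      rw [Finset.image_image]
      exact Finset.image_congr fun x hx => by simp [Finset.mem_coe.1 hx]
    have h2 : T'.image (fun x => if x ∈ T then 2 * f x else 2 * f' x + 1)
        = (T'.image f').image (2 * · + 1) := by
      rw [Finset.image_image]
      exact Finset.image_congr fun x hx => by simp [hnot x hx]
    have i1 : Function.Injective (2 * · : ℕ → ℕ) := fun a b h => by simpa using h
    have i2 : Function.Injective (2 * · + 1 : ℕ → ℕ) := fun a b h => by simpa using h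
    rw [Finset.image_union, h1, h2, Finset.card_union_of_disjoint,
      Finset.card_image_of_injective _ i1, Finset.card_image_of_injective _ i2]
    · have hsub : (H ∪ H') \ (T ∪ T') ⊆ (H \ T) ∪ (H' \ T') := by
        intro x
        simp only [Finset.mem_sdiff, Finset.mem_union]
        tauto
      have := (Finset.card_le_card hsub).trans (Finset.card_union_le _ _)
      lia
    · rw [Finset.disjoint_left]
      simp only [Finset.mem_image]
      rintro _ ⟨a, -, rfl⟩ ⟨b, -, h⟩
      lia

lemma IsScattered.join {A B T : Finset V} {k : ℕ} (h : IsScattered G A T (2 * B.card + k)) :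
    IsScattered G (B ∪ A) T k := by
  obtain ⟨hT, f, hf, hk⟩ := h
  refine ⟨hT.trans Finset.subset_union_right, f, hf, ?_⟩
  have hsub : (B ∪ A) \ T ⊆ B ∪ (A \ T) := by
    intro x
    simp only [Finset.mem_sdiff, Finset.mem_union]
    tauto
  have := (Finset.card_le_card hsub).trans (Finset.card_union_le _ _)
  lia

lemma IsScattered.not_tough [Fintype V] {T : Finset V} {k : ℕ}
    (h : IsScattered G Finset.univ T (k + 1)) (hT : T ≠ Finset.univ ∨ 1 ≤ k) :
    ¬ Tough (1 / 2 : ℝ) G := by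
  obtain ⟨-, f, hf, hk⟩ := h
  intro htough
  have hle := card_image_le_numComp (S := ((Finset.univ \ T : Finset V) : Set V)) (f := f)
    (T := T) (by simp) hf
  have h2 : 1 ≤ k ∨ 1 ≤ (Finset.univ \ T).card := by
    refine hT.symm.imp_right fun hT => ?_
    rw [Nat.succ_le_iff, Finset.card_pos, Finset.sdiff_nonempty]
    exact fun h => hT (Finset.univ_subset_iff.1 h)
  have h2' : 2 ≤ numComp G ((Finset.univ \ T : Finset V) : Set V) := by lia
  have := htough _ h2'
  rw [Set.ncard_coe_finset] at this
  have h3 : (numComp G ((Finset.univ \ T : Finset V) : Set V) : ℝ)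
      ≤ (2 * (Finset.univ \ T).card : ℕ) := by
    rw [Nat.cast_mul, Nat.cast_ofNat]
    linarith
  have := Nat.cast_le.1 h3
  lia

/-- A join is covered by a path joining the copies of a vertex unless one of its sides is too
scattered. -/
lemma verticalHamPath_or_isScattered_join {A B T : Finset V} {k : ℕ} (hB : B.Nonempty)
    (hd : Disjoint B A) (hAB : ∀ a ∈ A, ∀ b ∈ B, G.Adj a b) (hcard : B.card ≤ A.card)
    (hk : RisingCover G A A (k + 1)) (hT : IsScattered G A T (k + 1)) :
    VerticalHamPath G (B ∪ A) ∨ ∃ m T, T ≠ B ∪ A ∧ RisingCover G (B ∪ A) (B ∪ A) (m + 1) ∧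
      IsScattered G (B ∪ A) T (m + 1) := by
  by_cases h : k + 1 ≤ 2 * B.card
  · exact Or.inl (hk.verticalHamPath h hd hcard hAB)
  · right
    obtain ⟨m, rfl⟩ := Nat.exists_eq_add_of_le (show 2 * B.card ≤ k by lia)
    refine ⟨m, T, ?_, (hk.mergeAll hd hAB).mono Finset.subset_union_right, hT.join⟩
    rintro rfl
    obtain ⟨b, hb⟩ := hB
    exact Finset.disjoint_left.1 hd hb (hT.1 (by simp [hb]))

lemma exists_join_of_splits_compl {H : Finset V} (h : Splits Gᶜ H) :
    ∃ A B : Finset V, A.Nonempty ∧ B.Nonempty ∧ Disjoint B A ∧ B ∪ A = H ∧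
      B.card ≤ A.card ∧ ∀ a ∈ A, ∀ b ∈ B, G.Adj a b := by
  obtain ⟨A, B, hA, hB, hd, hH, hAB⟩ := h
  have hadj : ∀ a ∈ A, ∀ b ∈ B, G.Adj a b := by
    intro a ha b hb
    by_contra h
    refine hAB a ha b hb ((compl_adj ..).2 ⟨?_, h⟩)
    rintro rfl
    exact Finset.disjoint_left.1 hd ha hb
  rcases le_total B.card A.card with h | h
  · exact ⟨A, B, hA, hB, hd.symm, by rw [Finset.union_comm, hH], h, hadj⟩
  · exact ⟨B, A, hB, hA, hd, hH, h, fun b hb a ha => (hadj a ha b hb).symm⟩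

lemma ssubset_union_left {A B : Finset V} (hB : B.Nonempty) (hd : Disjoint A B) : A ⊂ A ∪ B := by
  obtain ⟨b, hb⟩ := hB
  exact Finset.subset_union_left.ssubset_of_mem_notMem (Finset.mem_union_right _ hb)
    (Finset.disjoint_right.1 hd hb)

lemma ssubset_union_right {A B : Finset V} (hA : A.Nonempty) (hd : Disjoint A B) :
    B ⊂ A ∪ B := by
  rw [Finset.union_comm]
  exact ssubset_union_left hA hd.symm

/-- In a `P₄`-free graph, the number of rising paths needed to cover a prism is attained by a
scattered set. -/
lemma exists_risingCover_isScattered (hG : NoInducedPath G) (H : Finset V) (hH : H.Nonempty) :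
    ∃ k T, RisingCover G H H (k + 1) ∧ IsScattered G H T (k + 1) := by
  induction H using Finset.strongInduction with
  | H H ih =>
    by_cases h2 : 2 ≤ H.card
    · rcases splits_or_splits_compl hG H h2 with h | h
      · obtain ⟨A, B, hA, hB, hd, rfl, hAB⟩ := h
        obtain ⟨k, T, hk, hT⟩ := ih A (ssubset_union_left hB hd) hA
        obtain ⟨k', T', hk', hT'⟩ := ih B (ssubset_union_right hA hd) hB
        refine ⟨k + 1 + k', T ∪ T', ?_, ?_⟩
        · exact hk.union hk' hd
        · exact hT.union hT' hd hAB
      · obtain ⟨A, B, hA, hB, hd, rfl, hcard, hAB⟩ := exists_join_of_splits_compl h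
        obtain ⟨k, T, hk, hT⟩ := ih A (ssubset_union_right hB hd) hA
        rcases verticalHamPath_or_isScattered_join hB hd hAB hcard hk hT with h | ⟨m, T, -, h⟩
        · exact ⟨0, _, h.risingCover, isScattered_self hH⟩
        · exact ⟨m, T, h⟩
    · obtain ⟨v, rfl⟩ := Finset.card_eq_one.1 (show H.card = 1 by have := hH.card_pos; lia)
      exact ⟨0, _, risingCover_singleton G v, isScattered_self hH⟩

lemma hasHamCycle_prism_of_tough [Fintype V] (hV : 2 ≤ Fintype.card V) (hG : NoInducedPath G)
    (h : Tough (1 / 2 : ℝ) G) : HasHamCycle (prism G) := by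
  refine VerticalHamPath.hasHamCycle hV ?_
  rcases splits_or_splits_compl hG Finset.univ hV with hs | hs
  · obtain ⟨A, B, hA, hB, hd, hU, hAB⟩ := hs
    have := (isScattered_self (G := G) hA).union (isScattered_self hB) hd hAB
    rw [hU] at this
    exact absurd h (this.not_tough (Or.inr le_rfl))
  · obtain ⟨A, B, hA, hB, hd, hU, hcard, hAB⟩ := exists_join_of_splits_compl hs
    obtain ⟨k, T, hk, hT⟩ := exists_risingCover_isScattered hG A hA
    have := verticalHamPath_or_isScattered_join hB hd hAB hcard hk hT
    rw [hU] at this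
    rcases this with hp | ⟨m, T, hne, -, hT⟩
    · exact hp
    · exact absurd h (hT.not_tough (Or.inl hne))

end Scattering

/-- A `P₄`-free graph with at least two vertices is
prism-hamiltonian if and only if it is `1/2`-tough. -/
theorem stmt_2 {V : Type*} [Fintype V] [DecidableEq V] (G : SimpleGraph V)
    (hcard : 2 ≤ Fintype.card V) (hP4 : P4Free G) :
    HasHamCycle (prism G) ↔ Tough (1 / 2 : ℝ) G := by
  refine ⟨fun h S hS => ?_, hasHamCycle_prism_of_tough hcard hP4.noInducedPath⟩
  have : (numComp G S : ℝ) ≤ (2 * S.ncard : ℕ) :=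
    Nat.cast_le.2 (numComp_le_of_hasHamCycle_prism h hS)
  push_cast at this
  linarith
end
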